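/- arXiv:2401.04265 — 8 statements merged into one kernel-verified Lean document; each statement's English description precedes it below -/
import Mathlib

section
/- Let μ be a probability measure on a measurable space 𝒳, let q, s : 𝒳 → ℝ be μ-integrable, and suppose |s(x)| ≤ C·|q(x)| for every x ∈ 𝒳, where C < ∞. Let π₁(x) := 1{q(x) > 0}. Then for every policy π₂ : 𝒳 → {0,1}, |∫ s(x)·(π₂(x) − π₁(x)) dμ(x)| ≤ C·(∫ q(x)·π₁(x) dμ(x) − ∫ q(x)·π₂(x) dμ(x)). -/
open MeasureTheory

/-- Under the pointwise boundedness condition `|s| ≤ C·|q|`, the Ψ-regret of any policy `π₂`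
relative to the plug-in Ω-optimal policy `π₁ = 1{q > 0}` is bounded by `C` times its Ω-regret. -/
theorem stmt_2 {𝒳 : Type*} [MeasurableSpace 𝒳] (μ : Measure 𝒳) [IsProbabilityMeasure μ]
    (q s : 𝒳 → ℝ) (hq : Integrable q μ) (hs : Integrable s μ)
    (C : ℝ) (hC : 0 ≤ C) (hbound : ∀ x, |s x| ≤ C * |q x|)
    (π₂ : 𝒳 → ℝ) (hπ₂ : Measurable π₂) (hπ₂01 : ∀ x, π₂ x = 0 ∨ π₂ x = 1) :
    |∫ x, s x * (π₂ x - (if 0 < q x then (1 : ℝ) else 0)) ∂μ|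
      ≤ C * ((∫ x, q x * (if 0 < q x then (1 : ℝ) else 0) ∂μ) - ∫ x, q x * π₂ x ∂μ) := by
  have h₁ : Integrable (fun x => q x * (if 0 < q x then (1 : ℝ) else 0)) μ := by
    refine hq.pos_part.congr (.of_forall fun x => ?_)
    dsimp only
    split_ifs with h
    · rw [max_eq_left h.le, mul_one]
    · rw [max_eq_right (not_lt.mp h), mul_zero]
  have h₂ : Integrable (fun x => q x * π₂ x) μ := by
    refine hq.mono (hq.aestronglyMeasurable.mul hπ₂.aestronglyMeasurable) (.of_forall fun x => ?_)
    rcases hπ₂01 x with h | h <;> simp [h]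
  rw [← integral_sub h₁ h₂, ← integral_const_mul, ← Real.norm_eq_abs]
  refine norm_integral_le_of_norm_le ((h₁.sub h₂).const_mul C) (.of_forall fun x => ?_)
  -- Both policies are binary, and `π₁` is pointwise optimal for `q`.
  have hregret : q x * (if 0 < q x then (1 : ℝ) else 0) - q x * π₂ x
      = |q x| * |π₂ x - (if 0 < q x then (1 : ℝ) else 0)| := by
    split_ifs with h
    · rcases hπ₂01 x with h' | h' <;> simp [h', abs_of_pos h]
    · rcases hπ₂01 x with h' | h' <;> simp [h', abs_of_nonpos (not_lt.mp h)]
  rw [Real.norm_eq_abs, abs_mul, hregret, ← mul_assoc]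
  exact mul_le_mul_of_nonneg_right (hbound x) (abs_nonneg _)
end

section
/- Let μ be a probability measure on a measurable space 𝒳, let q, s : 𝒳 → ℝ be μ-integrable with |s(x)| ≤ C·|q(x)| for every x ∈ 𝒳. If π₂ and π₃ are policies that both maximize π ↦ ∫ q(x)·π(x) dμ(x) over all policies (equivalently, ∫ q·π₂ dμ = ∫ q·π₃ dμ = ∫ q·π₁ dμ where π₁(x) = 1{q(x) > 0}), then ∫ s(x)·π₂(x) dμ(x) = ∫ s(x)·π₃(x) dμ(x). -/
open MeasureTheory

/-- A `{0,1}`-valued policy attaining the integral of the positive part of `q` realizes that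
positive part almost everywhere. -/
theorem mul_policy_ae_eq_of_integral_eq {𝒳 : Type*} [MeasurableSpace 𝒳] {μ : Measure 𝒳}
    {q π : 𝒳 → ℝ} (hq : Integrable q μ) (hπ : Measurable π) (hπ01 : ∀ x, π x = 0 ∨ π x = 1)
    (hopt : (∫ x, q x * π x ∂μ) = ∫ x, q x * (if 0 < q x then (1 : ℝ) else 0) ∂μ) :
    (fun x ↦ q x * π x) =ᵐ[μ] fun x ↦ max (q x) 0 := by
  have hpos : (fun x ↦ q x * (if 0 < q x then (1 : ℝ) else 0)) = fun x ↦ max (q x) 0 := by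
    funext x
    split_ifs with h
    · simp [h.le]
    · simp [not_lt.mp h]
  rw [hpos] at hopt
  have hint : Integrable (fun x ↦ q x * π x) μ :=
    hq.mul_bdd (c := 1) hπ.aestronglyMeasurable
      (.of_forall fun x ↦ by rcases hπ01 x with h | h <;> simp [h])
  refine (integral_eq_iff_of_ae_le hint hq.pos_part (.of_forall fun x ↦ ?_)).mp hopt
  rcases hπ01 x with h | h <;> simp [h]

/-- Under the boundedness condition `|s| ≤ C·|q|`, any two policies that both maximize the
Ω-value `π ↦ ∫ q·π dμ` (equivalently, achieve the Ω-value of the plug-in policy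
`π₁ = 1{q > 0}`) have the same Ψ-value `∫ s·π dμ`. -/
theorem stmt_3 {𝒳 : Type*} [MeasurableSpace 𝒳] (μ : Measure 𝒳) [IsProbabilityMeasure μ]
    (q s : 𝒳 → ℝ) (hq : Integrable q μ) (hs : Integrable s μ)
    (C : ℝ) (hC : 0 ≤ C) (hbound : ∀ x, |s x| ≤ C * |q x|)
    (π₂ π₃ : 𝒳 → ℝ) (hπ₂ : Measurable π₂) (hπ₂01 : ∀ x, π₂ x = 0 ∨ π₂ x = 1)
    (hπ₃ : Measurable π₃) (hπ₃01 : ∀ x, π₃ x = 0 ∨ π₃ x = 1)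
    (hopt₂ : (∫ x, q x * π₂ x ∂μ) = ∫ x, q x * (if 0 < q x then (1 : ℝ) else 0) ∂μ)
    (hopt₃ : (∫ x, q x * π₃ x ∂μ) = ∫ x, q x * (if 0 < q x then (1 : ℝ) else 0) ∂μ) :
    (∫ x, s x * π₂ x ∂μ) = ∫ x, s x * π₃ x ∂μ := by
  refine integral_congr_ae ?_
  filter_upwards [mul_policy_ae_eq_of_integral_eq hq hπ₂ hπ₂01 hopt₂,
    mul_policy_ae_eq_of_integral_eq hq hπ₃ hπ₃01 hopt₃] with x h₂ h₃
  rcases eq_or_ne (q x) 0 with h | h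
  · have hsx : s x = 0 := by simpa [h] using hbound x
    simp [hsx]
  · rw [mul_left_cancel₀ h (h₂.trans h₃.symm)]
end

section
/- Let μ be a probability measure on a measurable space 𝒳, let q, s : 𝒳 → ℝ be μ-integrable with |s(x)| ≤ C·|q(x)| for every x ∈ 𝒳, and let π₁(x) := 1{q(x) > 0}. Then for any two policies π₂, π₃ : 𝒳 → {0,1}, |∫ s·π₂ dμ − ∫ s·π₃ dμ| ≤ C·(2·∫ q·π₁ dμ − ∫ q·π₂ dμ − ∫ q·π₃ dμ). In particular, if Π̂ is any nonempty set of policies each of whose Ω-value ∫ q·π dμ is at least ∫ q·π₁ dμ − ε for some ε ≥ 0, then sup over π ∈ Π̂ of ∫ s·π dμ minus inf over π ∈ Π̂ of ∫ s·π dμ is at most 2·C·ε. -/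
open MeasureTheory

/-- A measurable `{0,1}`-valued weight preserves integrability. -/
theorem integrable_mul_of_zero_or_one {𝒳 : Type*} [MeasurableSpace 𝒳] {μ : Measure 𝒳}
    {f π : 𝒳 → ℝ} (hf : Integrable f μ) (hπ : Measurable π) (h01 : ∀ x, π x = 0 ∨ π x = 1) :
    Integrable (fun x => f x * π x) μ :=
  hf.mul_bdd (c := 1) hπ.aestronglyMeasurable
    (ae_of_all _ fun x => by rcases h01 x with h | h <;> simp [h])

theorem mul_ite_pos_eq_max (a : ℝ) : a * (if 0 < a then (1 : ℝ) else 0) = max a 0 := by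
  split_ifs with h
  · rw [mul_one, max_eq_left h.le]
  · rw [mul_zero, max_eq_right (not_lt.mp h)]

theorem abs_mul_sub_mul_le_of_zero_or_one {a b c u v : ℝ} (h : |b| ≤ c * |a|)
    (hc : 0 ≤ c) (hu : u = 0 ∨ u = 1) (hv : v = 0 ∨ v = 1) :
    |b * u - b * v| ≤ c * (2 * max a 0 - a * u - a * v) := by
  have h_abs : |a| = 2 * max a 0 - a := by
    rcases le_total a 0 with ha | ha
    · rw [abs_of_nonpos ha, max_eq_right ha]; ring
    · rw [abs_of_nonneg ha, max_eq_left ha]; ring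
  rw [h_abs] at h
  rcases hu with rfl | rfl <;> rcases hv with rfl | rfl
  · simpa using mul_nonneg hc (mul_nonneg zero_le_two (le_max_right a 0))
  · simpa using h
  · simpa using h
  · have := mul_nonneg hc (sub_nonneg.mpr (le_max_left a 0))
    rw [sub_self, abs_zero]
    linarith

theorem csSup_sub_csInf_le {S : Set ℝ} {d : ℝ} (hS : S.Nonempty)
    (h : ∀ a ∈ S, ∀ b ∈ S, a - b ≤ d) : sSup S - sInf S ≤ d := by
  rw [sub_le_iff_le_add]
  refine csSup_le hS fun a ha => ?_
  rw [← sub_le_iff_le_add']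
  exact le_csInf hS fun b hb => by linarith [h a ha b hb]

/-- Under the boundedness condition `|s| ≤ C·|q|`, with `π₁ = 1{q > 0}` the plug-in Ω-optimal
policy: (i) for any two policies `π₂, π₃`, the difference of their Ψ-values is bounded by
`C·(2·∫ q·π₁ − ∫ q·π₂ − ∫ q·π₃)`; (ii) consequently, over any nonempty set `Phat` of policies
that are `ε`-optimal for the Ω-value, the spread (sup minus inf) of Ψ-values is at most `2·C·ε`. -/
theorem stmt_4 {𝒳 : Type*} [MeasurableSpace 𝒳] (μ : Measure 𝒳) [IsProbabilityMeasure μ]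
    (q s : 𝒳 → ℝ) (hq : Integrable q μ) (hs : Integrable s μ)
    (C : ℝ) (hC : 0 ≤ C) (hbound : ∀ x, |s x| ≤ C * |q x|) :
    (∀ π₂ π₃ : 𝒳 → ℝ, Measurable π₂ → (∀ x, π₂ x = 0 ∨ π₂ x = 1) →
      Measurable π₃ → (∀ x, π₃ x = 0 ∨ π₃ x = 1) →
      |(∫ x, s x * π₂ x ∂μ) - ∫ x, s x * π₃ x ∂μ|
        ≤ C * (2 * (∫ x, q x * (if 0 < q x then (1 : ℝ) else 0) ∂μ)
            - (∫ x, q x * π₂ x ∂μ) - ∫ x, q x * π₃ x ∂μ)) ∧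
    ∀ (Phat : Set (𝒳 → ℝ)) (ε : ℝ), 0 ≤ ε → Phat.Nonempty →
      (∀ π ∈ Phat, Measurable π ∧ ∀ x, π x = 0 ∨ π x = 1) →
      (∀ π ∈ Phat,
        (∫ x, q x * (if 0 < q x then (1 : ℝ) else 0) ∂μ) - ε ≤ ∫ x, q x * π x ∂μ) →
      sSup ((fun π : 𝒳 → ℝ => ∫ x, s x * π x ∂μ) '' Phat)
          - sInf ((fun π : 𝒳 → ℝ => ∫ x, s x * π x ∂μ) '' Phat) ≤ 2 * C * ε := by
  have key : ∀ π₂ π₃ : 𝒳 → ℝ, Measurable π₂ → (∀ x, π₂ x = 0 ∨ π₂ x = 1) →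
      Measurable π₃ → (∀ x, π₃ x = 0 ∨ π₃ x = 1) →
      |(∫ x, s x * π₂ x ∂μ) - ∫ x, s x * π₃ x ∂μ|
        ≤ C * (2 * (∫ x, q x * (if 0 < q x then (1 : ℝ) else 0) ∂μ)
            - (∫ x, q x * π₂ x ∂μ) - ∫ x, q x * π₃ x ∂μ) := by
    intro π₂ π₃ hm₂ h₂ hm₃ h₃
    have hs₂ := integrable_mul_of_zero_or_one hs hm₂ h₂
    have hs₃ := integrable_mul_of_zero_or_one hs hm₃ h₃
    have hq₂ := integrable_mul_of_zero_or_one hq hm₂ h₂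
    have hq₃ := integrable_mul_of_zero_or_one hq hm₃ h₃
    have hq₁ : Integrable (fun x => 2 * max (q x) 0) μ := hq.pos_part.const_mul 2
    have hq₁₂ : Integrable (fun x => 2 * max (q x) 0 - q x * π₂ x) μ := hq₁.sub hq₂
    simp only [mul_ite_pos_eq_max]
    rw [← integral_sub hs₂ hs₃, ← integral_const_mul, ← integral_sub hq₁ hq₂,
      ← integral_sub hq₁₂ hq₃, ← integral_const_mul]
    exact abs_integral_le_integral_abs.trans <|
      integral_mono (hs₂.sub hs₃).abs ((hq₁₂.sub hq₃).const_mul C) fun x =>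
        abs_mul_sub_mul_le_of_zero_or_one (hbound x) hC (h₂ x) (h₃ x)
  refine ⟨key, fun Phat ε _ hne hpol hopt => csSup_sub_csInf_le (hne.image _) ?_⟩
  rintro _ ⟨π₂, hπ₂, rfl⟩ _ ⟨π₃, hπ₃, rfl⟩
  calc
    _ ≤ _ := le_abs_self _
    _ ≤ _ := key π₂ π₃ (hpol π₂ hπ₂).1 (hpol π₂ hπ₂).2 (hpol π₃ hπ₃).1 (hpol π₃ hπ₃).2
    _ ≤ C * (2 * ε) :=
      mul_le_mul_of_nonneg_left (by linarith [hopt π₂ hπ₂, hopt π₃ hπ₃]) hC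
    _ = 2 * C * ε := by ring
end

section
/- Let μ be a probability measure on a measurable space 𝒳 and let q, q̂, s : 𝒳 → ℝ be measurable. Suppose μ{x : |s(x)| ≥ C₁·t·|q(x)|} ≤ t^(−ζ) for all t > 1 (with C₁ > 0, ζ > 2) and μ{x : 0 < |q(x)| ≤ t} ≤ C₂·t^γ for all t > 0 (with C₂ < ∞, γ > 0). Let π*(x) := 1{q(x) > 0}, π̂(x) := 1{q̂(x) > 0}, and δ := ess sup_μ |q̂ − q| < ∞. Then there exists a finite constant K depending only on C₁, C₂, γ, ζ such that ∫ |s(x)|·1{π*(x) ≠ π̂(x)} dμ(x) ≤ K·δ^(1 + γ/2); in particular |∫ s(x)·(π̂(x) − π*(x)) dμ(x)| ≤ K·δ^(1 + γ/2). -/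
open MeasureTheory

/-- The lower integral of `t ^ (1 - ζ)` over `(1, ∞)` is finite for `ζ > 2`. -/
lemma lintegral_Ioi_rpow_ne_top {ζ : ℝ} (hζ : 2 < ζ) :
    ∫⁻ t in Set.Ioi (1 : ℝ), ENNReal.ofReal (t ^ (1 - ζ)) ≠ ⊤ := by
  have h : IntegrableOn (fun t : ℝ => t ^ (1 - ζ)) (Set.Ioi 1) :=
    integrableOn_Ioi_rpow_of_lt (by linarith) one_pos
  exact (h.lintegral_lt_top).ne

/-- A polynomial tail bound of order `ζ > 2` controls the second moment. -/
lemma lintegral_sq_le_of_tail {𝒳 : Type*} [MeasurableSpace 𝒳] {μ : Measure 𝒳}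
    [IsProbabilityMeasure μ] {f : 𝒳 → ℝ} (hf : Measurable f) (hf0 : ∀ x, 0 ≤ f x) {ζ : ℝ}
    (htail : ∀ t : ℝ, 1 < t → μ {x | t ≤ f x} ≤ ENNReal.ofReal (t ^ (-ζ))) :
    ∫⁻ x, ENNReal.ofReal (f x ^ 2) ∂μ ≤
      2 * (1 + ∫⁻ t in Set.Ioi (1 : ℝ), ENNReal.ofReal (t ^ (1 - ζ))) := by
  have layer := lintegral_rpow_eq_lintegral_meas_le_mul μ (Filter.Eventually.of_forall hf0)
    hf.aemeasurable (p := 2) two_pos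
  simp only [Real.rpow_two] at layer
  rw [layer, ENNReal.ofReal_ofNat]
  gcongr
  rw [← Set.Ioc_union_Ioi_eq_Ioi (zero_le_one (α := ℝ))]
  refine (lintegral_union_le _ _ _).trans ?_
  gcongr ?_ + ?_
  · calc _ ≤ ∫⁻ _ in Set.Ioc (0 : ℝ) 1, 1 := by
          refine setLIntegral_mono measurable_const fun t ht => ?_
          refine mul_le_one' prob_le_one ?_
          rw [ENNReal.ofReal_le_one]
          norm_num
          exact ht.2
      _ = 1 := by simp
  · refine setLIntegral_mono (by fun_prop) fun t ht => ?_
    have ht0 : 0 < t := one_pos.trans ht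
    refine (mul_le_mul_left (htail t ht) _).trans_eq ?_
    rw [← ENNReal.ofReal_mul (by positivity), ← Real.rpow_add ht0]
    congr 2
    ring

/-- If the sign indicators of `a` and `b` differ, then `|a|` is at most their distance. -/
lemma abs_le_of_posInd_ne {a b δ : ℝ} (hab : |b - a| ≤ δ)
    (h : (if 0 < a then (1 : ℝ) else 0) ≠ (if 0 < b then (1 : ℝ) else 0)) : |a| ≤ δ := by
  rw [abs_le] at hab ⊢
  split_ifs at h <;> first | exact absurd rfl h | constructor <;> linarith

/-- Under the ratio tail bound, `q` vanishes only on a null set. -/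
lemma ae_ne_zero_of_ratio_tail {𝒳 : Type*} [MeasurableSpace 𝒳] {μ : Measure 𝒳} {q s : 𝒳 → ℝ}
    {C ζ : ℝ} (hζ : 0 < ζ)
    (htail : ∀ t : ℝ, 1 < t → μ {x | C * t * |q x| ≤ |s x|} ≤ ENNReal.ofReal (t ^ (-ζ))) :
    ∀ᵐ x ∂μ, q x ≠ 0 := by
  have hlim : Filter.Tendsto (fun t : ℝ => ENNReal.ofReal (t ^ (-ζ))) Filter.atTop (nhds 0) := by
    simpa using ENNReal.tendsto_ofReal (tendsto_rpow_neg_atTop hζ)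
  rw [ae_iff, ← nonpos_iff_eq_zero]
  refine ge_of_tendsto hlim ?_
  filter_upwards [Filter.eventually_gt_atTop 1] with t ht
  refine (measure_mono fun x hx => ?_).trans (htail t ht)
  have hx0 : q x = 0 := by simpa using hx
  simp [hx0]

/-- If `|s| ≤ C δ f` on `D`, with second moment of `f` at most `M` and
`μ D ≤ B δ ^ γ`, then the integral of `|s|` over `D` is of order `δ ^ (1 + γ / 2)`. -/
lemma setLIntegral_abs_le_rpow {𝒳 : Type*} [MeasurableSpace 𝒳] {μ : Measure 𝒳} {f s : 𝒳 → ℝ}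
    (hf : Measurable f) {D : Set 𝒳} {C B γ δ : ℝ} (hC : 0 ≤ C) (hδ : 0 < δ)
    {M : ENNReal} (hM : M ≠ ⊤) (hsq : ∫⁻ x, ENNReal.ofReal (f x ^ 2) ∂μ ≤ M)
    (hD : μ D ≤ ENNReal.ofReal (B * δ ^ γ)) (hB : 0 ≤ B)
    (hs : ∀ᵐ x ∂μ.restrict D, |s x| ≤ C * δ * f x) :
    ∫⁻ x in D, ENNReal.ofReal |s x| ∂μ ≤
      ENNReal.ofReal (C * (M.toReal + B) * δ ^ (1 + γ / 2)) := by
  set l := δ ^ (γ / 2) with hl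
  have hl0 : 0 < l := Real.rpow_pos_of_pos hδ _
  have hγl : δ ^ γ = l * l := by rw [hl, ← Real.rpow_add hδ]; congr 1; ring
  have hδl : δ ^ (1 + γ / 2) = δ * l := by rw [Real.rpow_add hδ, Real.rpow_one]
  have young : ∀ y : ℝ, y ≤ l * y ^ 2 + l⁻¹ := fun y => by
    have h : l * y ^ 2 + l⁻¹ - y = l⁻¹ * ((l * y - 1 / 2) ^ 2 + 3 / 4) := by field_simp; ring
    have : 0 ≤ l⁻¹ * ((l * y - 1 / 2) ^ 2 + 3 / 4) := by positivity
    linarith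
  calc ∫⁻ x in D, ENNReal.ofReal |s x| ∂μ
      ≤ ∫⁻ x in D, (ENNReal.ofReal (C * δ * l) * ENNReal.ofReal (f x ^ 2)
          + ENNReal.ofReal (C * δ * l⁻¹)) ∂μ := by
        refine lintegral_mono_ae ?_
        filter_upwards [hs] with x hx
        rw [← ENNReal.ofReal_mul (by positivity), ← ENNReal.ofReal_add (by positivity)
          (by positivity)]
        refine ENNReal.ofReal_le_ofReal (hx.trans ?_)
        calc C * δ * f x ≤ C * δ * (l * f x ^ 2 + l⁻¹) := by gcongr; exact young _
          _ = _ := by ring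
    _ = ENNReal.ofReal (C * δ * l) * ∫⁻ x in D, ENNReal.ofReal (f x ^ 2) ∂μ
          + ENNReal.ofReal (C * δ * l⁻¹) * μ D := by
        rw [lintegral_add_right _ measurable_const, lintegral_const_mul _ (by fun_prop)]
        simp
    _ ≤ ENNReal.ofReal (C * δ * l) * ENNReal.ofReal M.toReal
          + ENNReal.ofReal (C * δ * l⁻¹) * ENNReal.ofReal (B * δ ^ γ) := by
        rw [ENNReal.ofReal_toReal hM]
        gcongr
        exact (setLIntegral_le_lintegral _ _).trans hsq
    _ = ENNReal.ofReal (C * (M.toReal + B) * δ ^ (1 + γ / 2)) := by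
        rw [← ENNReal.ofReal_mul (by positivity), ← ENNReal.ofReal_mul (by positivity),
          ← ENNReal.ofReal_add (by positivity) (by positivity), hγl, hδl]
        congr 1
        field_simp

/-- The set where two plug-in policies disagree is measurable. -/
lemma measurableSet_posInd_ne {𝒳 : Type*} [MeasurableSpace 𝒳] {q r : 𝒳 → ℝ}
    (hq : Measurable q) (hr : Measurable r) :
    MeasurableSet
      {x | (if 0 < q x then (1 : ℝ) else 0) ≠ (if 0 < r x then (1 : ℝ) else 0)} := by
  have hind : ∀ {g : 𝒳 → ℝ}, Measurable g →
      Measurable fun x => if 0 < g x then (1 : ℝ) else 0 := fun hg =>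
    Measurable.ite (measurableSet_lt measurable_const hg) measurable_const measurable_const
  exact (measurableSet_eq_fun (hind hq) (hind hr)).compl

/-- The Ψ-value difference of two policies is at most the integral of `|s|` where they differ. -/
lemma abs_integral_mul_posInd_sub_le {𝒳 : Type*} [MeasurableSpace 𝒳] {μ : Measure 𝒳}
    {q r s : 𝒳 → ℝ} (hq : Measurable q) (hr : Measurable r) {b : ℝ} (hb : 0 ≤ b)
    (h : (∫⁻ x in {x | (if 0 < q x then (1 : ℝ) else 0) ≠ (if 0 < r x then (1 : ℝ) else 0)},
        ENNReal.ofReal |s x| ∂μ) ≤ ENNReal.ofReal b) :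
    |∫ x, s x * ((if 0 < r x then (1 : ℝ) else 0) - (if 0 < q x then (1 : ℝ) else 0)) ∂μ|
      ≤ b := by
  rw [← ENNReal.ofReal_le_ofReal_iff hb, ← Real.enorm_eq_ofReal_abs]
  refine (enorm_integral_le_lintegral_enorm _).trans (le_trans (le_of_eq ?_) h)
  rw [← lintegral_indicator (measurableSet_posInd_ne hq hr)]
  refine lintegral_congr fun x => ?_
  by_cases h1 : 0 < q x <;> by_cases h2 : 0 < r x <;>
    simp [Set.indicator, h1, h2, Real.enorm_eq_ofReal_abs]

/-- Proposition 2 of the paper: under the margin conditions (Conditions 1 and 2, with `ζ > 2`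
and `γ > 0`), there is a finite constant `K` depending only on `C₁, C₂, γ, ζ` such that for any
probability measure, any true and estimated primary CATEs `q, qhat` with
`ess sup |qhat − q| ≤ δ`, and any integrable subsidiary CATE `s`, the Ψ-value discrepancy
between the plug-in policies satisfies `∫ |s|·1{π* ≠ π̂} dμ ≤ K·δ^(1+γ/2)`, and in particular
`|∫ s·(π̂ − π*) dμ| ≤ K·δ^(1+γ/2)`. -/
theorem stmt_9 (C₁ C₂ γ ζ : ℝ) (hC₁ : 0 < C₁) (hζ : 2 < ζ) (hγ : 0 < γ) :
    ∃ K : ℝ, 0 ≤ K ∧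
      ∀ (𝒳 : Type*) (_ : MeasurableSpace 𝒳) (μ : Measure 𝒳), IsProbabilityMeasure μ →
      ∀ q qhat s : 𝒳 → ℝ, Measurable q → Measurable qhat → Measurable s → Integrable s μ →
      ∀ δ : ℝ, 0 ≤ δ → (∀ᵐ x ∂μ, |qhat x - q x| ≤ δ) →
      (∀ t : ℝ, 1 < t →
        μ {x | C₁ * t * |q x| ≤ |s x|} ≤ ENNReal.ofReal (t ^ (-ζ))) →
      (∀ t : ℝ, 0 < t →
        μ {x | 0 < |q x| ∧ |q x| ≤ t} ≤ ENNReal.ofReal (C₂ * t ^ γ)) →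
      (∫⁻ x in {x | (if 0 < q x then (1 : ℝ) else 0) ≠ (if 0 < qhat x then (1 : ℝ) else 0)},
          ENNReal.ofReal |s x| ∂μ) ≤ ENNReal.ofReal (K * δ ^ (1 + γ / 2)) ∧
      |∫ x, s x * ((if 0 < qhat x then (1 : ℝ) else 0) - (if 0 < q x then (1 : ℝ) else 0)) ∂μ|
        ≤ K * δ ^ (1 + γ / 2) := by
  set M : ENNReal := 2 * (1 + ∫⁻ t in Set.Ioi (1 : ℝ), ENNReal.ofReal (t ^ (1 - ζ)))
  have hM : M ≠ ⊤ := ENNReal.mul_ne_top ENNReal.ofNat_ne_top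
    (ENNReal.add_ne_top.2 ⟨ENNReal.one_ne_top, lintegral_Ioi_rpow_ne_top hζ⟩)
  have hK : 0 ≤ C₁ * (M.toReal + max C₂ 0) := by positivity
  refine ⟨C₁ * (M.toReal + max C₂ 0), hK, ?_⟩
  intro 𝒳 _ μ _ q qhat s hq hqhat hs _ δ hδ hclose htail hmargin
  have hb : 0 ≤ C₁ * (M.toReal + max C₂ 0) * δ ^ (1 + γ / 2) := by positivity
  suffices hbound : _ from ⟨hbound, abs_integral_mul_posInd_sub_le hq hqhat hb hbound⟩
  set D := {x | (if 0 < q x then (1 : ℝ) else 0) ≠ (if 0 < qhat x then (1 : ℝ) else 0)}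
  have hq0 : ∀ᵐ x ∂μ, q x ≠ 0 := ae_ne_zero_of_ratio_tail (by linarith) htail
  have hDq : ∀ᵐ x ∂μ, x ∈ D → 0 < |q x| ∧ |q x| ≤ δ := by
    filter_upwards [hq0, hclose] with x hx0 hx hxD
    exact ⟨abs_pos.2 hx0, abs_le_of_posInd_ne hx hxD⟩
  rcases hδ.eq_or_lt with rfl | hδ
  · have hD0 : μ D = 0 := by
      rw [← compl_compl D]
      refine mem_ae_iff.1 ?_
      filter_upwards [hDq] with x hx hxD
      exact absurd (hx hxD).2 (not_le.2 (hx hxD).1)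
    rw [setLIntegral_measure_zero _ _ hD0]
    exact zero_le
  · have hf : Measurable fun x => |s x| / (C₁ * |q x|) := by fun_prop
    refine setLIntegral_abs_le_rpow hf hC₁.le hδ hM
      (lintegral_sq_le_of_tail hf (fun x => by positivity) fun t ht => ?_) ?_
      (le_max_right _ _) ?_
    · refine (measure_mono fun x hx => ?_).trans (htail t ht)
      rcases eq_or_ne (q x) 0 with hx0 | hx0
      · simp [hx0]
      · have hpos : 0 < C₁ * |q x| := by positivity
        have := (le_div_iff₀ hpos).1 hx
        simp only [Set.mem_ofPred_eq]
        linarith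
    · refine (measure_mono_ae hDq).trans ((hmargin δ hδ).trans ?_)
      gcongr
      exact le_max_left _ _
    · rw [ae_restrict_iff' (measurableSet_posInd_ne hq hqhat)]
      filter_upwards [hDq] with x hx hxD
      obtain ⟨hpos, hle⟩ := hx hxD
      calc |s x| = C₁ * |q x| * (|s x| / (C₁ * |q x|)) := by field_simp
        _ ≤ C₁ * δ * (|s x| / (C₁ * |q x|)) := by gcongr
end

section
/- Let μ be a probability measure on a measurable space 𝒳 and let q, s : 𝒳 → ℝ be measurable with C₃ := ess sup_μ |s| < ∞. Suppose μ{x : |s(x)| ≥ C₁·t·|q(x)|} ≤ t^(−ζ) for all t > 1 (with C₁ > 0, ζ > 0) and μ{x : 0 < |q(x)| ≤ t} ≤ C₂·t^γ for all t > 0 (with C₂ < ∞, γ > 0). Then for every δ > 0 and every t ∈ (0,1), ∫ 1{0 < |q(x)| < δ}·(|s(x)| + δ) dμ(x) ≤ (C₁·t^(−1)·δ + δ)·C₂·δ^γ + (C₃ + δ)·t^ζ. -/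
open MeasureTheory

/-- The splitting inequality at the heart of the pathwise differentiability proof (Lemma 1):
under the two margin conditions and with `C₃` an essential bound on `|s|`, for every `δ > 0`
and every `t ∈ (0,1)`,
`∫ 1{0 < |q| < δ}·(|s| + δ) dμ ≤ (C₁·t⁻¹·δ + δ)·C₂·δ^γ + (C₃ + δ)·t^ζ`. -/
theorem stmt_11 {𝒳 : Type*} [MeasurableSpace 𝒳] (μ : Measure 𝒳) [IsProbabilityMeasure μ]
    (q s : 𝒳 → ℝ) (hq : Measurable q) (hs : Measurable s)
    (C₁ C₂ C₃ γ ζ : ℝ) (hC₁ : 0 < C₁) (hζ : 0 < ζ) (hγ : 0 < γ)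
    (hC₃ : ∀ᵐ x ∂μ, |s x| ≤ C₃)
    (hmargin₁ : ∀ t : ℝ, 1 < t →
      μ {x | C₁ * t * |q x| ≤ |s x|} ≤ ENNReal.ofReal (t ^ (-ζ)))
    (hmargin₂ : ∀ t : ℝ, 0 < t →
      μ {x | 0 < |q x| ∧ |q x| ≤ t} ≤ ENNReal.ofReal (C₂ * t ^ γ)) :
    ∀ δ t : ℝ, 0 < δ → 0 < t → t < 1 →
      (∫⁻ x in {x | 0 < |q x| ∧ |q x| < δ}, ENNReal.ofReal (|s x| + δ) ∂μ)
        ≤ ENNReal.ofReal ((C₁ * t⁻¹ * δ + δ) * (C₂ * δ ^ γ) + (C₃ + δ) * t ^ ζ) := by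
  intro δ t hδ ht ht1
  set A : Set 𝒳 := {x | 0 < |q x| ∧ |q x| < δ}
  set B : Set 𝒳 := {x | C₁ * t⁻¹ * |q x| ≤ |s x|}
  have hAm : MeasurableSet A :=
    (measurableSet_lt measurable_const hq.abs).inter (measurableSet_lt hq.abs measurable_const)
  have hBm : MeasurableSet B := measurableSet_le (hq.abs.const_mul _) hs.abs
  have hμA : μ A ≤ ENNReal.ofReal (C₂ * δ ^ γ) :=
    le_trans (measure_mono fun _ hx => And.imp_right le_of_lt hx) (hmargin₂ δ hδ)
  have hμB : μ B ≤ ENNReal.ofReal (t ^ ζ) := by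
    have h := hmargin₁ t⁻¹ ((one_lt_inv₀ ht).2 ht1)
    rwa [Real.rpow_neg (inv_nonneg.2 ht.le), Real.inv_rpow ht.le, inv_inv] at h
  have hC₃0 : 0 ≤ C₃ := by
    obtain ⟨x, hx⟩ := hC₃.exists
    exact (abs_nonneg _).trans hx
  rcases lt_or_ge C₂ 0 with hC₂ | hC₂
  · have hA0 : μ A = 0 := by
      rw [ENNReal.ofReal_of_nonpos
        (mul_nonpos_of_nonpos_of_nonneg hC₂.le (Real.rpow_nonneg hδ.le γ))] at hμA
      exact le_antisymm hμA zero_le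
    rw [setLIntegral_measure_zero _ _ hA0]
    exact zero_le
  have hpoint : ∀ᵐ x ∂μ.restrict A, ENNReal.ofReal (|s x| + δ) ≤
      ENNReal.ofReal (C₁ * t⁻¹ * δ + δ) +
        B.indicator (fun _ => ENNReal.ofReal (C₃ + δ)) x := by
    filter_upwards [ae_restrict_of_ae hC₃, ae_restrict_mem hAm] with x hx hxA
    by_cases hxB : x ∈ B
    · rw [Set.indicator_of_mem hxB]
      exact (ENNReal.ofReal_le_ofReal (by linarith)).trans le_add_self
    · rw [Set.indicator_of_notMem hxB, add_zero]
      have hlt : |s x| < C₁ * t⁻¹ * |q x| := not_le.1 hxB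
      have hle : C₁ * t⁻¹ * |q x| ≤ C₁ * t⁻¹ * δ :=
        mul_le_mul_of_nonneg_left hxA.2.le (by positivity)
      exact ENNReal.ofReal_le_ofReal (by linarith)
  calc ∫⁻ x in A, ENNReal.ofReal (|s x| + δ) ∂μ
      ≤ ∫⁻ x in A, (ENNReal.ofReal (C₁ * t⁻¹ * δ + δ) +
          B.indicator (fun _ => ENNReal.ofReal (C₃ + δ)) x) ∂μ := lintegral_mono_ae hpoint
    _ = ENNReal.ofReal (C₁ * t⁻¹ * δ + δ) * μ A +
          ENNReal.ofReal (C₃ + δ) * μ.restrict A B := by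
        rw [lintegral_add_left measurable_const, setLIntegral_const,
          lintegral_indicator_const hBm]
    _ ≤ ENNReal.ofReal (C₁ * t⁻¹ * δ + δ) * ENNReal.ofReal (C₂ * δ ^ γ) +
          ENNReal.ofReal (C₃ + δ) * ENNReal.ofReal (t ^ ζ) := by
        gcongr
        exact (Measure.restrict_apply_le A B).trans hμB
    _ = ENNReal.ofReal ((C₁ * t⁻¹ * δ + δ) * (C₂ * δ ^ γ) + (C₃ + δ) * t ^ ζ) := by
        rw [← ENNReal.ofReal_mul (by positivity), ← ENNReal.ofReal_mul (by positivity),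
          ← ENNReal.ofReal_add (by positivity) (by positivity)]
end

section
/- Let μ be a probability measure on a measurable space 𝒳 and let q, s : 𝒳 → ℝ be measurable with ess sup_μ |s| < ∞. Suppose μ{x : |s(x)| ≥ C₁·t·|q(x)|} ≤ t^(−ζ) for all t > 1 (with C₁ > 0, ζ > 0) and μ{x : 0 < |q(x)| ≤ t} ≤ C₂·t^γ for all t > 0 (with C₂ < ∞ and γ·ζ > 1). Then lim_{δ → 0⁺} δ^(−1) · ∫ 1{0 < |q(x)| < δ}·(|s(x)| + δ) dμ(x) = 0. -/
open MeasureTheory Filter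

/-- Splitting bound: off `{C * |q| ≤ |s|}` the integrand is at most `(C + 1) * δ`, and on it the
excess is at most the essential bound of `|s|`. -/
lemma lintegral_abs_add_le_of_margin {𝒳 : Type*} [MeasurableSpace 𝒳] (μ : Measure 𝒳)
    {q s : 𝒳 → ℝ} (hq : Measurable q) (hs : Measurable s) {C M δ : ℝ} (hC : 0 ≤ C) (hM : 0 ≤ M)
    (hδ : 0 ≤ δ) (hsM : ∀ᵐ x ∂μ, |s x| ≤ M) :
    ∫⁻ x in {x | 0 < |q x| ∧ |q x| < δ}, ENNReal.ofReal (|s x| + δ) ∂μ ≤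
      ENNReal.ofReal ((C + 1) * δ) * μ {x | 0 < |q x| ∧ |q x| ≤ δ} +
        ENNReal.ofReal M * μ {x | C * |q x| ≤ |s x|} := by
  have hS : MeasurableSet {x | 0 < |q x| ∧ |q x| < δ} :=
    (measurableSet_lt measurable_const hq.abs).inter (measurableSet_lt hq.abs measurable_const)
  have hB : MeasurableSet {x | C * |q x| ≤ |s x|} :=
    measurableSet_le (hq.abs.const_mul C) hs.abs
  calc
    _ ≤ ∫⁻ x in {x | 0 < |q x| ∧ |q x| < δ}, (ENNReal.ofReal ((C + 1) * δ) +
          {x | C * |q x| ≤ |s x|}.indicator (fun _ => ENNReal.ofReal M) x) ∂μ := by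
      refine lintegral_mono_ae ?_
      filter_upwards [ae_restrict_of_ae hsM, ae_restrict_mem hS] with x hx hxS
      have hCδ : C * |q x| ≤ C * δ := mul_le_mul_of_nonneg_left hxS.2.le hC
      by_cases hxB : C * |q x| ≤ |s x|
      · rw [Set.indicator_of_mem (by exact hxB), ← ENNReal.ofReal_add (by positivity) hM]
        exact ENNReal.ofReal_le_ofReal (by nlinarith)
      · rw [Set.indicator_of_notMem (by exact hxB), add_zero]
        exact ENNReal.ofReal_le_ofReal (by nlinarith)
    _ = ENNReal.ofReal ((C + 1) * δ) * μ {x | 0 < |q x| ∧ |q x| < δ} +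
          ENNReal.ofReal M * μ.restrict {x | 0 < |q x| ∧ |q x| < δ} {x | C * |q x| ≤ |s x|} := by
      rw [lintegral_add_left measurable_const, setLIntegral_const, lintegral_indicator_const hB]
    _ ≤ _ := by
      gcongr
      · exact fun h => h.le
      · exact Measure.restrict_le_self

/-- The `o(δ)` estimate at the heart of the pathwise differentiability result: under the two
margin conditions with `γ·ζ > 1` and `|s|` essentially bounded,
`δ⁻¹ · ∫ 1{0 < |q| < δ}·(|s| + δ) dμ → 0` as `δ → 0⁺`. -/
theorem stmt_12 {𝒳 : Type*} [MeasurableSpace 𝒳] (μ : Measure 𝒳) [IsProbabilityMeasure μ]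
    (q s : 𝒳 → ℝ) (hq : Measurable q) (hs : Measurable s)
    (C₁ C₂ C₃ γ ζ : ℝ) (hC₁ : 0 < C₁) (hζ : 0 < ζ) (hγζ : 1 < γ * ζ)
    (hC₃ : ∀ᵐ x ∂μ, |s x| ≤ C₃)
    (hmargin₁ : ∀ t : ℝ, 1 < t →
      μ {x | C₁ * t * |q x| ≤ |s x|} ≤ ENNReal.ofReal (t ^ (-ζ)))
    (hmargin₂ : ∀ t : ℝ, 0 < t →
      μ {x | 0 < |q x| ∧ |q x| ≤ t} ≤ ENNReal.ofReal (C₂ * t ^ γ)) :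
    Tendsto
      (fun δ : ℝ => δ⁻¹ *
        (∫⁻ x in {x | 0 < |q x| ∧ |q x| < δ}, ENNReal.ofReal (|s x| + δ) ∂μ).toReal)
      (nhdsWithin 0 (Set.Ioi 0)) (nhds 0) := by
  obtain ⟨a, ha₁, ha₂⟩ : ∃ a, 1 / ζ < a ∧ a < γ :=
    exists_between ((div_lt_iff₀ hζ).2 hγζ)
  have ha : 0 < a := (one_div_pos.2 hζ).trans ha₁
  have haζ : 1 < a * ζ := (div_lt_iff₀ hζ).1 ha₁
  have hpow (e : ℝ) (he : 0 < e) :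
      Tendsto (fun δ : ℝ => δ ^ e) (nhdsWithin 0 (Set.Ioi 0)) (nhds 0) := by
    have h := (Real.continuousAt_rpow_const 0 e (Or.inr he.le)).tendsto
    rw [Real.zero_rpow he.ne'] at h
    exact h.mono_left nhdsWithin_le_nhds
  have hlim : Tendsto (fun δ : ℝ => C₁ * |C₂| * δ ^ (γ - a) + |C₂| * δ ^ γ +
      |C₃| * δ ^ (a * ζ - 1)) (nhdsWithin 0 (Set.Ioi 0)) (nhds 0) := by
    simpa using (((hpow _ (sub_pos.2 ha₂)).const_mul (C₁ * |C₂|)).add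
      ((hpow _ (ha.trans ha₂)).const_mul |C₂|)).add
        ((hpow _ (sub_pos.2 haζ)).const_mul |C₃|)
  refine squeeze_zero' ?_ ?_ hlim
  · filter_upwards [self_mem_nhdsWithin] with δ hδ
    exact mul_nonneg (inv_nonneg.2 (le_of_lt hδ)) ENNReal.toReal_nonneg
  filter_upwards [Ioo_mem_nhdsGT (zero_lt_one' ℝ)] with δ ⟨hδ, hδ1⟩
  have ht : 1 < δ ^ (-a) := Real.one_lt_rpow_of_pos_of_lt_one_of_neg hδ hδ1 (neg_lt_zero.2 ha)
  have hbound : ∫⁻ x in {x | 0 < |q x| ∧ |q x| < δ}, ENNReal.ofReal (|s x| + δ) ∂μ ≤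
      ENNReal.ofReal ((C₁ * δ ^ (-a) + 1) * δ * (|C₂| * δ ^ γ) + |C₃| * (δ ^ (-a)) ^ (-ζ)) := by
    refine (lintegral_abs_add_le_of_margin μ hq hs (C := C₁ * δ ^ (-a)) (M := |C₃|)
      (by positivity) (abs_nonneg _) hδ.le (hC₃.mono fun x hx => hx.trans (le_abs_self _))).trans ?_
    rw [ENNReal.ofReal_add (by positivity) (by positivity),
      ENNReal.ofReal_mul (by positivity : 0 ≤ (C₁ * δ ^ (-a) + 1) * δ),
      ENNReal.ofReal_mul (abs_nonneg C₃)]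
    gcongr
    · exact (hmargin₂ δ hδ).trans (ENNReal.ofReal_le_ofReal (by gcongr; exact le_abs_self _))
    · exact hmargin₁ _ ht
  calc
    _ ≤ δ⁻¹ * ((C₁ * δ ^ (-a) + 1) * δ * (|C₂| * δ ^ γ) + |C₃| * (δ ^ (-a)) ^ (-ζ)) := by
      gcongr
      exact ENNReal.toReal_le_of_le_ofReal (by positivity) hbound
    _ = _ := by
      rw [← Real.rpow_mul hδ.le, neg_mul_neg, Real.rpow_sub_one hδ.ne', sub_eq_add_neg,
        Real.rpow_add hδ]
      field_simp
end

section
/- Let μ₀ be a probability measure on a measurable space 𝒳 and let S : 𝒳 → ℝ be measurable with ∫ S dμ₀ = 0 and |S(x)| ≤ m for all x. For ε with |ε| < 1/m define the probability measure μ_ε with density (1 + ε·S) with respect to μ₀. Let q₀, s₀ : 𝒳 → ℝ be measurable with ess sup |s₀| < ∞, let h̄, h̃ : 𝒳 → ℝ be measurable with |h̄| ≤ H and |h̃| ≤ H, and set q_ε := q₀ + ε·h̄ and s_ε := s₀ + ε·h̃. Suppose μ₀{x : |s₀(x)| ≥ C₁·t·|q₀(x)|} ≤ t^(−ζ) for all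 t > 1 (with C₁ > 0, ζ > 0) and μ₀{x : 0 < |q₀(x)| ≤ t} ≤ C₂·t^γ for all t > 0 (with C₂ < ∞ and γ·ζ > 1). Then lim_{ε → 0} (1/ε) · ∫ (1{q_ε(x) > 0} − 1{q₀(x) > 0}) · s_ε(x) dμ_ε(x) = 0. -/
open MeasureTheory Filter

theorem tendsto_rpow_abs_nhdsNE_zero {a : ℝ} (ha : 0 < a) :
    Tendsto (fun ε : ℝ => |ε| ^ a) (nhdsWithin 0 {0}ᶜ) (nhds 0) := by
  have h : ContinuousAt (fun ε : ℝ => |ε| ^ a) 0 :=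
    continuous_abs.continuousAt.rpow_const (Or.inr ha.le)
  have h' := h.tendsto
  simp only [abs_zero, Real.zero_rpow ha.ne'] at h'
  exact h'.mono_left nhdsWithin_le_nhds

theorem abs_ite_pos_sub_ite_pos_le (a b : ℝ) :
    |(if 0 < a then (1 : ℝ) else 0) - (if 0 < b then (1 : ℝ) else 0)| ≤ 1 := by
  split_ifs <;> norm_num

theorem abs_le_of_ite_pos_sub_ite_pos_ne_zero {q d : ℝ}
    (h : (if 0 < q + d then (1 : ℝ) else 0) - (if 0 < q then (1 : ℝ) else 0) ≠ 0) :
    |q| ≤ |d| := by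
  have h₁ := neg_abs_le d
  have h₂ := le_abs_self d
  rw [abs_le]
  split_ifs at h
  · simp at h
  · constructor <;> linarith
  · constructor <;> linarith
  · simp at h

/-- A margin condition on `|s| / |q|` forces `q` to be nonzero almost everywhere. -/
theorem ae_ne_zero_of_margin {𝒳 : Type*} [MeasurableSpace 𝒳] {μ : Measure 𝒳}
    {q s : 𝒳 → ℝ} {C ζ : ℝ} (hζ : 0 < ζ)
    (h : ∀ t : ℝ, 1 < t → μ {x | C * t * |q x| ≤ |s x|} ≤ ENNReal.ofReal (t ^ (-ζ))) :
    ∀ᵐ x ∂μ, q x ≠ 0 := by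
  have hlim : Tendsto (fun t : ℝ => ENNReal.ofReal (t ^ (-ζ))) atTop (nhds 0) := by
    simpa [Function.comp_def] using
      (ENNReal.continuous_ofReal.tendsto 0).comp (tendsto_rpow_neg_atTop hζ)
  have hle : μ {x | q x = 0} ≤ 0 := by
    refine ge_of_tendsto hlim ?_
    filter_upwards [eventually_gt_atTop 1] with t ht
    refine (measure_mono fun x hx => ?_).trans (h t ht)
    have hx' : q x = 0 := hx
    simp [hx']
  rw [ae_iff]
  simpa using hle

/-- Integrals against the tilted measure of a function dominated by two indicators. -/
theorem abs_integral_withDensity_le {𝒳 : Type*} [MeasurableSpace 𝒳] {μ : Measure 𝒳}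
    [IsFiniteMeasure μ] {w f : 𝒳 → ℝ} {A B : Set 𝒳} {a b : ℝ} (hw : Measurable w)
    (hw₀ : ∀ x, 0 ≤ w x) (hw₂ : ∀ x, w x ≤ 2) (hA : MeasurableSet A) (hB : MeasurableSet B)
    (hf : ∀ᵐ x ∂μ, |f x| ≤ A.indicator (fun _ => a) x + B.indicator (fun _ => b) x) :
    |∫ x, f x ∂(μ.withDensity fun x => ENNReal.ofReal (w x))|
      ≤ 2 * (a * μ.real A + b * μ.real B) := by
  rw [integral_withDensity_eq_integral_toReal_smul (by fun_prop) (by simp)]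
  have hiA : Integrable (A.indicator fun _ => a) μ := (integrable_const a).indicator hA
  have hiB : Integrable (B.indicator fun _ => b) μ := (integrable_const b).indicator hB
  have hint : ∫ x, 2 * (A.indicator (fun _ => a) x + B.indicator (fun _ => b) x) ∂μ
      = 2 * (a * μ.real A + b * μ.real B) := by
    rw [integral_const_mul, integral_add hiA hiB, integral_indicator_const _ hA,
      integral_indicator_const _ hB]
    simp [mul_comm]
  rw [← hint, ← Real.norm_eq_abs]
  refine norm_integral_le_of_norm_le ((hiA.add hiB).const_mul 2) ?_
  filter_upwards [hf] with x hx
  rw [ENNReal.toReal_ofReal (hw₀ x), smul_eq_mul, norm_mul, Real.norm_of_nonneg (hw₀ x)]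
  exact mul_le_mul (hw₂ x) hx (abs_nonneg _) (by norm_num)

/-- The analytic core of Lemma 1: along a bounded-score submodel `μ_ε` with density `1 + ε·S`
with respect to `μ₀`, and with perturbed CATEs `q_ε = q₀ + ε·hbar` and `s_ε = s₀ + ε·htilde`
(`hbar`, `htilde` bounded by `H`), under the margin conditions with `γ·ζ > 1`,
`(1/ε) · ∫ (1{q_ε > 0} − 1{q₀ > 0})·s_ε dμ_ε → 0` as `ε → 0`. -/
theorem stmt_13 {𝒳 : Type*} [MeasurableSpace 𝒳] (μ₀ : Measure 𝒳) [IsProbabilityMeasure μ₀]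
    (S : 𝒳 → ℝ) (hS : Measurable S) (m : ℝ) (hm : 0 < m)
    (hSmean : (∫ x, S x ∂μ₀) = 0) (hSbdd : ∀ x, |S x| ≤ m)
    (q₀ s₀ hbar htilde : 𝒳 → ℝ)
    (hq₀ : Measurable q₀) (hs₀ : Measurable s₀)
    (hhbar : Measurable hbar) (hhtilde : Measurable htilde)
    (C₀ : ℝ) (hs₀bdd : ∀ᵐ x ∂μ₀, |s₀ x| ≤ C₀)
    (H : ℝ) (hHbar : ∀ x, |hbar x| ≤ H) (hHtilde : ∀ x, |htilde x| ≤ H)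
    (C₁ C₂ γ ζ : ℝ) (hC₁ : 0 < C₁) (hζ : 0 < ζ) (hγζ : 1 < γ * ζ)
    (hmargin₁ : ∀ t : ℝ, 1 < t →
      μ₀ {x | C₁ * t * |q₀ x| ≤ |s₀ x|} ≤ ENNReal.ofReal (t ^ (-ζ)))
    (hmargin₂ : ∀ t : ℝ, 0 < t →
      μ₀ {x | 0 < |q₀ x| ∧ |q₀ x| ≤ t} ≤ ENNReal.ofReal (C₂ * t ^ γ)) :
    Tendsto
      (fun ε : ℝ => ε⁻¹ *
        ∫ x, ((if 0 < q₀ x + ε * hbar x then (1 : ℝ) else 0)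
              - (if 0 < q₀ x then (1 : ℝ) else 0)) * (s₀ x + ε * htilde x)
          ∂(μ₀.withDensity fun x => ENNReal.ofReal (1 + ε * S x)))
      (nhdsWithin 0 {0}ᶜ) (nhds 0) := by
  have hζγ : ζ⁻¹ < γ := by
    rw [inv_eq_one_div, div_lt_iff₀ hζ]
    exact hγζ
  obtain ⟨a, ha₁, ha₂⟩ := exists_between hζγ
  have ha₀ : 0 < a := (inv_pos.2 hζ).trans ha₁
  have haζ : 1 < a * ζ := by
    rwa [inv_eq_one_div, div_lt_iff₀ hζ] at ha₁
  have hγ : 0 < γ := ha₀.trans ha₂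
  have hH : 0 ≤ H := by
    obtain ⟨x⟩ := (inferInstance : (ae μ₀).NeBot).nonempty
    exact (abs_nonneg _).trans (hHbar x)
  obtain ⟨K, hK, hHK⟩ : ∃ K : ℝ, 0 < K ∧ H ≤ K := ⟨H + 1, by linarith, by linarith⟩
  have hlim : Tendsto (fun ε : ℝ => 2 * |C₀| * |ε| ^ (a * ζ - 1)
      + 2 * K * |C₂| * K ^ γ * (C₁ * |ε| ^ (γ - a) + |ε| ^ γ))
      (nhdsWithin 0 {0}ᶜ) (nhds 0) := by
    have h₁ := tendsto_rpow_abs_nhdsNE_zero (sub_pos.2 haζ)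
    have h₂ := tendsto_rpow_abs_nhdsNE_zero (sub_pos.2 ha₂)
    have h₃ := tendsto_rpow_abs_nhdsNE_zero hγ
    simpa using (h₁.const_mul (2 * |C₀|)).add
      (((h₂.const_mul C₁).add h₃).const_mul (2 * K * |C₂| * K ^ γ))
  refine squeeze_zero_norm' ?_ hlim
  have hsmall : ∀ᶠ ε : ℝ in nhdsWithin 0 {0}ᶜ, |ε| < min 1 m⁻¹ := by
    refine nhdsWithin_le_nhds ?_
    have : ContinuousAt (fun ε : ℝ => |ε|) 0 := continuous_abs.continuousAt
    exact this.eventually_lt_const (by simpa using hm)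
  have hq₀ne : ∀ᵐ x ∂μ₀, q₀ x ≠ 0 := ae_ne_zero_of_margin hζ hmargin₁
  filter_upwards [hsmall, self_mem_nhdsWithin] with ε hε hε₀
  have he : 0 < |ε| := abs_pos.2 hε₀
  have he₁ : |ε| < 1 := hε.trans_le (min_le_left _ _)
  have hem : |ε| * m < 1 := by
    have := hε.trans_le (min_le_right _ _)
    rwa [inv_eq_one_div, lt_div_iff₀ hm] at this
  have hεS : ∀ x, |ε * S x| ≤ 1 := fun x => by
    rw [abs_mul]
    exact (mul_le_mul_of_nonneg_left (hSbdd x) he.le).trans hem.le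
  have hεK : ∀ h : ℝ, |h| ≤ H → |ε * h| ≤ K * |ε| := fun h hh => by
    rw [abs_mul, mul_comm K]
    exact mul_le_mul_of_nonneg_left (hh.trans hHK) he.le
  set t : ℝ := |ε| ^ (-a) with ht
  have ht₁ : 1 < t := Real.one_lt_rpow_of_pos_of_lt_one_of_neg he he₁ (neg_lt_zero.2 ha₀)
  set A : Set 𝒳 := {x | C₁ * t * |q₀ x| ≤ |s₀ x|}
  set B : Set 𝒳 := {x | 0 < |q₀ x| ∧ |q₀ x| ≤ K * |ε|}
  have hA : MeasurableSet A := measurableSet_le (by fun_prop) (by fun_prop)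
  have hB : MeasurableSet B :=
    (measurableSet_lt measurable_const hq₀.abs).inter (measurableSet_le hq₀.abs measurable_const)
  have hμA : μ₀.real A ≤ |ε| ^ (a * ζ) := by
    have h := ENNReal.toReal_le_of_le_ofReal (by positivity) (hmargin₁ t ht₁)
    rwa [ht, ← Real.rpow_mul he.le, neg_mul_neg] at h
  have hμB : μ₀.real B ≤ |C₂| * (K ^ γ * |ε| ^ γ) := by
    rw [← Real.mul_rpow hK.le he.le]
    refine ENNReal.toReal_le_of_le_ofReal (by positivity)
      ((hmargin₂ (K * |ε|) (by positivity)).trans (ENNReal.ofReal_le_ofReal ?_))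
    exact mul_le_mul_of_nonneg_right (le_abs_self _) (by positivity)
  have hI := abs_integral_withDensity_le (μ := μ₀) (w := fun x => 1 + ε * S x)
    (f := fun x => ((if 0 < q₀ x + ε * hbar x then (1 : ℝ) else 0)
      - (if 0 < q₀ x then (1 : ℝ) else 0)) * (s₀ x + ε * htilde x))
    (a := |C₀|) (b := (C₁ * t + 1) * (K * |ε|)) (by fun_prop)
    (fun x => by linarith [(abs_le.1 (hεS x)).1]) (fun x => by linarith [(abs_le.1 (hεS x)).2])
    hA hB (by
      filter_upwards [hq₀ne, hs₀bdd] with x hx hsx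
      have hA₀ : 0 ≤ A.indicator (fun _ => |C₀|) x :=
        Set.indicator_nonneg (fun _ _ => abs_nonneg _) x
      have hB₀ : 0 ≤ B.indicator (fun _ => (C₁ * t + 1) * (K * |ε|)) x :=
        Set.indicator_nonneg (fun _ _ => by positivity) x
      by_cases hd : (if 0 < q₀ x + ε * hbar x then (1 : ℝ) else 0)
          - (if 0 < q₀ x then (1 : ℝ) else 0) = 0
      · rw [hd, zero_mul, abs_zero]
        exact add_nonneg hA₀ hB₀
      have hqx : |q₀ x| ≤ K * |ε| :=
        (abs_le_of_ite_pos_sub_ite_pos_ne_zero hd).trans (hεK _ (hHbar x))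
      have hxB : x ∈ B := ⟨abs_pos.2 hx, hqx⟩
      have hf : |((if 0 < q₀ x + ε * hbar x then (1 : ℝ) else 0)
          - (if 0 < q₀ x then (1 : ℝ) else 0)) * (s₀ x + ε * htilde x)| ≤ |s₀ x| + K * |ε| := by
        rw [abs_mul]
        refine (mul_le_of_le_one_left (abs_nonneg _) (abs_ite_pos_sub_ite_pos_le _ _)).trans ?_
        exact (abs_add_le _ _).trans (by linarith [hεK _ (hHtilde x)])
      refine hf.trans ?_
      rw [Set.indicator_of_mem hxB]
      have hpos : 0 ≤ C₁ * t * (K * |ε|) := by positivity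
      by_cases hxA : x ∈ A
      · rw [Set.indicator_of_mem hxA]
        linarith [le_abs_self C₀]
      · rw [Set.indicator_of_notMem hxA]
        have h₁ : |s₀ x| < C₁ * t * |q₀ x| := not_le.1 hxA
        have h₂ : C₁ * t * |q₀ x| ≤ C₁ * t * (K * |ε|) :=
          mul_le_mul_of_nonneg_left hqx (by positivity)
        linarith)
  rw [norm_mul, norm_inv, Real.norm_eq_abs, Real.norm_eq_abs]
  calc |ε|⁻¹ * _ ≤ |ε|⁻¹ * (2 * (|C₀| * |ε| ^ (a * ζ)
        + (C₁ * t + 1) * (K * |ε|) * (|C₂| * (K ^ γ * |ε| ^ γ)))) := by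
        refine mul_le_mul_of_nonneg_left (hI.trans ?_) (by positivity)
        gcongr
    _ = _ := by
        rw [Real.rpow_sub_one he.ne', sub_eq_neg_add γ a, Real.rpow_add he, ← ht]
        field_simp
end

section
/- Let Π be a nonempty set, t > 0, and let ω, ω̂, σ̂ : Π → ℝ with ω and ω̂ bounded, and 0 < σ_min ≤ σ̂(π) ≤ σ_max < ∞ for all π ∈ Π. Suppose |ω̂(π) − ω(π)| ≤ σ̂(π)·t for every π ∈ Π, and define Π̂ := {π ∈ Π : sup_{π' ∈ Π} (ω̂(π') − σ̂(π')·t) ≤ ω̂(π) + σ̂(π)·t}. Then Π̂ is nonempty and sup_{π ∈ Π} ω(π) − inf_{π ∈ Π̂} ω(π) ≤ 4·t·sup_{π ∈ Π} σ̂(π). -/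
/-- Deterministic core of Lemma 7: if the two-sided uniform band `|ωhat − ω| ≤ σhat·t` is valid
with `0 < σmin ≤ σhat ≤ σmax < ∞` and `ω, ωhat` bounded, then the first-stage set
`Π̂ = {π : sup_{π'} (ωhat π' − σhat π' · t) ≤ ωhat π + σhat π · t}` is nonempty and every
policy in it has Ω-regret at most `4·t·sup σhat`. -/
theorem stmt_18 {Pol : Type*} [Nonempty Pol] (t : ℝ) (ht : 0 < t)
    (ω ωhat σhat : Pol → ℝ)
    (hωa : BddAbove (Set.range ω)) (hωb : BddBelow (Set.range ω))
    (hωha : BddAbove (Set.range ωhat)) (hωhb : BddBelow (Set.range ωhat))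
    (σmin σmax : ℝ) (hσmin : 0 < σmin)
    (hσ : ∀ π, σmin ≤ σhat π ∧ σhat π ≤ σmax)
    (hband : ∀ π, |ωhat π - ω π| ≤ σhat π * t) :
    {π : Pol | (⨆ π', (ωhat π' - σhat π' * t)) ≤ ωhat π + σhat π * t}.Nonempty ∧
    (⨆ π, ω π)
        - sInf (ω '' {π : Pol | (⨆ π', (ωhat π' - σhat π' * t)) ≤ ωhat π + σhat π * t})
      ≤ 4 * t * ⨆ π, σhat π := by
  have hσa : BddAbove (Set.range σhat) := ⟨σmax, by rintro _ ⟨π, rfl⟩; exact (hσ π).2⟩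
  have hLa : BddAbove (Set.range fun π' => ωhat π' - σhat π' * t) := by
    obtain ⟨B, hB⟩ := hωha
    refine ⟨B, ?_⟩
    rintro _ ⟨π, rfl⟩
    have hωπ : ωhat π ≤ B := hB ⟨π, rfl⟩
    have hσt : 0 < σhat π * t := mul_pos (hσmin.trans_le (hσ π).1) ht
    change ωhat π - σhat π * t ≤ B
    linarith
  have hne : {π : Pol | (⨆ π', (ωhat π' - σhat π' * t)) ≤ ωhat π + σhat π * t}.Nonempty := by
    obtain ⟨π, hπ⟩ := exists_lt_of_lt_ciSup
      (sub_lt_self (⨆ π', (ωhat π' - σhat π' * t)) (by positivity : 0 < 2 * (σmin * t)))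
    have hσt : σmin * t ≤ σhat π * t := mul_le_mul_of_nonneg_right (hσ π).1 ht.le
    refine ⟨π, ?_⟩
    change _ ≤ ωhat π + σhat π * t
    linarith
  refine ⟨hne, ?_⟩
  have hS (π : Pol) : σhat π * t ≤ (⨆ π, σhat π) * t :=
    mul_le_mul_of_nonneg_right (le_ciSup hσa π) ht.le
  have hsup : (⨆ π, ω π) ≤ (⨆ π', (ωhat π' - σhat π' * t)) + 2 * ((⨆ π, σhat π) * t) := by
    refine ciSup_le fun π => ?_
    have hL := le_ciSup hLa π
    have hb := abs_le.mp (hband π)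
    linarith [hS π, hb.1]
  have hinf : (⨆ π', (ωhat π' - σhat π' * t)) - 2 * ((⨆ π, σhat π) * t) ≤
      sInf (ω '' {π : Pol | (⨆ π', (ωhat π' - σhat π' * t)) ≤ ωhat π + σhat π * t}) := by
    refine le_csInf (hne.image ω) ?_
    rintro _ ⟨π, hπ, rfl⟩
    have hb := abs_le.mp (hband π)
    have hL : (⨆ π', (ωhat π' - σhat π' * t)) ≤ ωhat π + σhat π * t := hπ
    linarith [hS π, hb.2]
  linarith
end
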